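/- In the mixture of spherical Gaussians model with common variance (σ_i² = σ² for all i) and d ≥ k, let μ := E[x], Σ₂ := E[xxᵀ], and M_2 := Σ_{i=1}^k w_i μ_i μ_iᵀ (which has rank k under non-degeneracy). Let μ̂ ∈ ℝ^d and let Σ̂₂ ∈ ℝ^{d×d} be any symmetric matrix; let σ̂² be the k-th largest eigenvalue of Σ̂₂ − μ̂μ̂ᵀ, and let M̂_2 be a best rank-k approximation in spectral norm to Σ̂₂ − σ̂² I. Then (1) |σ̂² − σ²| ≤ ‖Σ̂₂ − Σ₂‖₂ + 2‖μ‖₂‖μ̂ − μ‖₂ + ‖μ̂ − μ‖₂², and (2) ‖M̂_2 − M_2‖₂ ≤ 4‖Σ̂₂ − Σ₂‖₂ + 4‖μ‖₂‖μ̂ − μ‖₂ + 2‖μ̂ − μ‖₂². -/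

import Mathlib

open MeasureTheory ProbabilityTheory Matrix
open scoped BigOperators NNReal

/-- Euclidean (ℓ²) norm of a vector in `Fin m → ℝ`. -/
noncomputable def l2norm {m : ℕ} (v : Fin m → ℝ) : ℝ :=
  Real.sqrt (∑ i, v i ^ 2)

/-- Spectral norm (ℓ² operator norm) of a real matrix. -/
noncomputable def spec {m n : ℕ} (M : Matrix (Fin m) (Fin n) ℝ) : ℝ :=
  ‖LinearMap.toContinuousLinearMap (Matrix.toEuclideanLin M)‖

/-- `t`-th largest entry (1-indexed) of a tuple of reals. -/
noncomputable def kthLargest {d : ℕ} (f : Fin d → ℝ) (t : ℕ) : ℝ :=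
  if h : d - t < d then f (Tuple.sort f ⟨d - t, h⟩) else 0


lemma l2norm_eq {m : ℕ} (v : Fin m → ℝ) : l2norm v = ‖WithLp.toLp 2 v‖ := by
  simp [l2norm, EuclideanSpace.norm_eq]

lemma l2norm_sq {m : ℕ} (v : Fin m → ℝ) : l2norm v ^ 2 = v ⬝ᵥ v := by
  unfold l2norm
  rw [Real.sq_sqrt (Finset.sum_nonneg fun i _ => sq_nonneg _)]
  simp [dotProduct, sq]

lemma abs_dot_le {m : ℕ} (u v : Fin m → ℝ) : |u ⬝ᵥ v| ≤ l2norm u * l2norm v := by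
  rw [l2norm_eq, l2norm_eq]
  have := abs_real_inner_le_norm (WithLp.toLp 2 v) (WithLp.toLp 2 u)
  rw [mul_comm]
  simpa [EuclideanSpace.inner_eq_star_dotProduct] using this

lemma quad_le {m : ℕ} (M : Matrix (Fin m) (Fin m) ℝ) (v : Fin m → ℝ) :
    |v ⬝ᵥ M *ᵥ v| ≤ spec M * (v ⬝ᵥ v) := by
  have h1 := abs_dot_le v (M *ᵥ v)
  have h2 : l2norm (M *ᵥ v) ≤ spec M * l2norm v := by
    rw [l2norm_eq, l2norm_eq]
    exact (LinearMap.toContinuousLinearMap (Matrix.toEuclideanLin M)).le_opNorm (WithLp.toLp 2 v)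
  have h3 : 0 ≤ l2norm v := Real.sqrt_nonneg _
  rw [← l2norm_sq]
  nlinarith

lemma spec_add_le {m : ℕ} (M N : Matrix (Fin m) (Fin m) ℝ) :
    spec (M + N) ≤ spec M + spec N := by
  unfold spec
  rw [map_add, map_add]
  exact norm_add_le _ _

lemma spec_neg {m : ℕ} (M : Matrix (Fin m) (Fin m) ℝ) : spec (-M) = spec M := by
  unfold spec
  rw [map_neg, map_neg, norm_neg]

lemma spec_smul_one_le {m : ℕ} (c : ℝ) :
    spec (c • (1 : Matrix (Fin m) (Fin m) ℝ)) ≤ |c| := by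
  unfold spec
  refine ContinuousLinearMap.opNorm_le_bound _ (abs_nonneg _) fun x => ?_
  have : (LinearMap.toContinuousLinearMap (Matrix.toEuclideanLin
      (c • (1 : Matrix (Fin m) (Fin m) ℝ)))) x = c • x := by
    ext i
    simp
  rw [this, norm_smul, Real.norm_eq_abs]

lemma vecMulVec_quad {m : ℕ} (u v : Fin m → ℝ) :
    v ⬝ᵥ (Matrix.vecMulVec u u) *ᵥ v = (u ⬝ᵥ v) ^ 2 := by
  rw [Matrix.vecMulVec_mulVec, sq]
  simp [dotProduct_comm]

lemma pi_memLp {d : ℕ} (m : Fin d → ℝ) (s : ℝ≥0) (i : Fin d) :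
    MemLp (fun y : Fin d → ℝ => y i) 2 (Measure.pi fun j => gaussianReal (m j) s) := by
  have hp := measurePreserving_eval (fun j => gaussianReal (m j) s) i
  exact (memLp_id_gaussianReal (μ := m i) (v := s) 2).comp_measurePreserving hp

lemma pi_mean {d : ℕ} (m : Fin d → ℝ) (s : ℝ≥0) (i : Fin d) :
    ∫ y, y i ∂(Measure.pi fun j => gaussianReal (m j) s) = m i := by
  have hp := measurePreserving_eval (fun j => gaussianReal (m j) s) i
  have := integral_map (μ := Measure.pi fun j => gaussianReal (m j) s)
    hp.measurable.aemeasurable (f := fun t : ℝ => t) (by fun_prop)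
  rw [hp.map_eq, integral_id_gaussianReal] at this
  exact this.symm

lemma pi_second {d : ℕ} (m : Fin d → ℝ) (s : ℝ≥0) (i j : Fin d) :
    ∫ y, y i * y j ∂(Measure.pi fun j => gaussianReal (m j) s)
      = m i * m j + (if i = j then (s : ℝ) else 0) := by
  by_cases hij : i = j
  · subst hij
    have hp := measurePreserving_eval (fun j => gaussianReal (m j) s) i
    have := integral_map (μ := Measure.pi fun j => gaussianReal (m j) s)
      hp.measurable.aemeasurable (f := fun t : ℝ => t * t) (by fun_prop)
    rw [hp.map_eq] at this
    have hv := variance_eq_sub (memLp_id_gaussianReal (μ := m i) (v := s) 2)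
    rw [variance_id_gaussianReal] at hv
    simp only [Pi.pow_apply, id, integral_id_gaussianReal, sq] at hv
    simp only [Function.eval] at this
    rw [← this]
    simp
    linarith
  · have hI := (iIndepFun_pi (μ := fun j => gaussianReal (m j) s)
      (X := fun _ t => t) (fun _ => aemeasurable_id')).indepFun hij
    have := hI.integral_mul_eq_mul_integral (measurable_pi_apply i).aestronglyMeasurable
      (measurable_pi_apply j).aestronglyMeasurable
    simp only [Pi.mul_apply, pi_mean] at this
    simp [hij, this]

lemma mix_integral {Ω : Type} [MeasurableSpace Ω] (P : Measure Ω) [IsProbabilityMeasure P]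
    {d k : ℕ} (w : Fin k → ℝ) (ν : Fin k → Measure (Fin d → ℝ))
    (h : Ω → Fin k) (x : Ω → Fin d → ℝ)
    (hmeas_h : Measurable h) (hmeas_x : Measurable x)
    (hw_pos : ∀ i, 0 < w i)
    (hprob : ∀ i, P (h ⁻¹' {i}) = ENNReal.ofReal (w i))
    (hcond : ∀ i, (ProbabilityTheory.cond P (h ⁻¹' {i})).map x = ν i)
    (f : (Fin d → ℝ) → ℝ) (hf : Measurable f) (hfi : ∀ i, Integrable f (ν i)) :
    ∫ ω, f (x ω) ∂P = ∑ i, w i * ∫ y, f y ∂(ν i) := by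
  have hi : ∀ i, Integrable (fun ω => f (x ω)) (ProbabilityTheory.cond P (h ⁻¹' {i})) := by
    intro i
    have := hfi i
    rw [← hcond i] at this
    exact this.comp_measurable hmeas_x
  conv_lhs => rw [← sum_meas_smul_cond_fiber hmeas_h P]
  rw [integral_finsetSum_measure]
  · refine Finset.sum_congr rfl fun i _ => ?_
    rw [integral_smul_measure, hprob, ENNReal.toReal_ofReal (hw_pos i).le, ← hcond i,
      integral_map hmeas_x.aemeasurable hf.aestronglyMeasurable, smul_eq_mul]
  · intro i _
    exact (hi i).smul_measure (by simp)

lemma eig_orth {d : ℕ} {S : Matrix (Fin d) (Fin d) ℝ} (hS : S.IsHermitian) (i j : Fin d) :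
    (hS.eigenvectorBasis i).ofLp ⬝ᵥ (hS.eigenvectorBasis j).ofLp = if i = j then 1 else 0 := by
  have := orthonormal_iff_ite.1 hS.eigenvectorBasis.orthonormal j i
  rw [EuclideanSpace.inner_eq_star_dotProduct] at this
  simpa [eq_comm] using this

/-- lower bound -/
lemma kth_lower {d k : ℕ} (hk : 0 < k) (hdk : k ≤ d) {S : Matrix (Fin d) (Fin d) ℝ}
    (hS : S.IsHermitian) (c : ℝ) (H : ∀ v : Fin d → ℝ, c * (v ⬝ᵥ v) ≤ v ⬝ᵥ S *ᵥ v) :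
    c ≤ kthLargest hS.eigenvalues k := by
  have hlt : d - k < d := by omega
  rw [kthLargest, dif_pos hlt]
  set j := Tuple.sort hS.eigenvalues ⟨d - k, hlt⟩
  have := H (hS.eigenvectorBasis j).ofLp
  rw [hS.mulVec_eigenvectorBasis, dotProduct_smul, eig_orth] at this
  simpa using this

/-- upper bound -/
lemma kth_upper {d k : ℕ} (hk : 0 < k) (hdk : k ≤ d) {S : Matrix (Fin d) (Fin d) ℝ}
    (hS : S.IsHermitian) (c : ℝ) (w : Fin k → ℝ) (a : Fin k → Fin d → ℝ)
    (hw : ∀ i, 0 < w i) (ha : ∑ i, w i • a i = 0)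
    (H : ∀ v : Fin d → ℝ, (∀ i, a i ⬝ᵥ v = 0) → v ⬝ᵥ S *ᵥ v ≤ c * (v ⬝ᵥ v)) :
    kthLargest hS.eigenvalues k ≤ c := by
  have hlt : d - k < d := by omega
  rw [kthLargest, dif_pos hlt]
  set L := hS.eigenvalues (Tuple.sort hS.eigenvalues ⟨d - k, hlt⟩) with hL
  let e : Fin k → Fin d := fun j => Tuple.sort hS.eigenvalues ⟨d - k + j, by omega⟩
  have he : Function.Injective e := by
    intro p q hpq
    have := (Tuple.sort hS.eigenvalues).injective hpq
    simp at this
    exact Fin.ext this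
  have hLe : ∀ j, L ≤ hS.eigenvalues (e j) := by
    intro j
    exact Tuple.monotone_sort hS.eigenvalues (by simp [Fin.le_def])
  let u : Fin k → Fin d → ℝ := fun j => (hS.eigenvectorBasis (e j)).ofLp
  have hu : ∀ i j, u i ⬝ᵥ u j = if i = j then 1 else 0 := by
    intro i j
    simp only [u, eig_orth, he.eq_iff]
  have hSu : ∀ j, S *ᵥ u j = hS.eigenvalues (e j) • u j := fun j =>
    hS.mulVec_eigenvectorBasis (e j)
  let B : Matrix (Fin k) (Fin k) ℝ := Matrix.of fun i j => a i ⬝ᵥ u j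
  have hB : w ᵥ* B = 0 := by
    ext j
    have : w ᵥ* B = fun j => (∑ i, w i • a i) ⬝ᵥ u j := by
      ext j
      simp [B, Matrix.vecMul, dotProduct, sum_dotProduct, Finset.sum_mul, Finset.mul_sum, mul_assoc]
      rw [Finset.sum_comm]
    rw [this, ha]
    simp
  have hw0 : w ≠ 0 := by
    intro h0
    have := hw ⟨0, hk⟩
    rw [h0] at this
    simp at this
  have hdet : B.det = 0 := Matrix.exists_vecMul_eq_zero_iff.1 ⟨w, hw0, hB⟩
  obtain ⟨z, hz0, hz⟩ := Matrix.exists_mulVec_eq_zero_iff.2 hdet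
  have key := H (∑ j, z j • u j) (by
    intro i
    have := congrFun hz i
    simp only [B, Matrix.mulVec, dotProduct, Matrix.of_apply, Pi.zero_apply] at this
    simp only [dotProduct_sum, dotProduct_smul, smul_eq_mul]
    rw [← this]
    refine Finset.sum_congr rfl fun j _ => ?_
    rw [mul_comm]; rfl)
  have e1 : (∑ j, z j • u j) ⬝ᵥ (∑ j, z j • u j) = ∑ j, z j ^ 2 := by
    simp [dotProduct_sum, sum_dotProduct, hu, sq]
  have e2 : (∑ j, z j • u j) ⬝ᵥ S *ᵥ (∑ j, z j • u j)
      = ∑ j, hS.eigenvalues (e j) * z j ^ 2 := by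
    simp only [Matrix.mulVec_sum, Matrix.mulVec_smul, hSu]
    simp [dotProduct_sum, sum_dotProduct, hu, sq]
    refine Finset.sum_congr rfl fun j _ => by ring
  rw [e1, e2] at key
  have hpos : 0 < ∑ j, z j ^ 2 := by
    obtain ⟨j, hj⟩ := Function.ne_iff.1 hz0
    exact Finset.sum_pos' (fun i _ => sq_nonneg _) ⟨j, Finset.mem_univ _, by
      have : z j ≠ 0 := hj
      positivity⟩
  have h3 : L * ∑ j, z j ^ 2 ≤ ∑ j, hS.eigenvalues (e j) * z j ^ 2 := by
    rw [Finset.mul_sum]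
    exact Finset.sum_le_sum fun j _ => mul_le_mul_of_nonneg_right (hLe j) (sq_nonneg _)
  exact le_of_mul_le_mul_right (h3.trans key) hpos

lemma rank_M2 {d k : ℕ} (w : Fin k → ℝ) (μ : Fin k → Fin d → ℝ) :
    (∑ i, w i • Matrix.vecMulVec (μ i) (μ i)).rank ≤ k := by
  have : (∑ i, w i • Matrix.vecMulVec (μ i) (μ i))
      = (Matrix.of fun (r : Fin d) (c : Fin k) => w c * μ c r) * (Matrix.of μ) := by
    ext r s
    simp [Matrix.mul_apply, Matrix.sum_apply, Matrix.vecMulVec_apply, mul_assoc]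
  rw [this]
  refine (Matrix.rank_mul_le_left _ _).trans ?_
  exact (Matrix.rank_le_width _)

/-- **Accuracy of `σ̂²` and `M̂₂`.**
In the mixture of spherical Gaussians model with common variance `σ²` and `d ≥ k`, let
`μ = E[x]`, `Σ₂ = E[xxᵀ]`, `M₂ = ∑ i, w i μ_i μ_iᵀ`. For any `μ̂` and symmetric `Σ̂₂`, let
`σ̂²` be the `k`-th largest eigenvalue of `Σ̂₂ − μ̂μ̂ᵀ` and `M̂₂` a best rank-`k`
approximation (in spectral norm) to `Σ̂₂ − σ̂² I`. Then
`|σ̂² − σ²| ≤ ‖Σ̂₂ − Σ₂‖₂ + 2‖μ‖₂‖μ̂ − μ‖₂ + ‖μ̂ − μ‖₂²` and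
`‖M̂₂ − M₂‖₂ ≤ 4‖Σ̂₂ − Σ₂‖₂ + 4‖μ‖₂‖μ̂ − μ‖₂ + 2‖μ̂ − μ‖₂²`. -/
theorem accuracy_sigma2_M2
    {Ω : Type} [MeasurableSpace Ω] (P : Measure Ω) [IsProbabilityMeasure P]
    (d k : ℕ) (hk : 0 < k) (hdk : k ≤ d)
    (w : Fin k → ℝ) (μ : Fin k → Fin d → ℝ) (σ2 : ℝ≥0)
    (h : Ω → Fin k) (x : Ω → Fin d → ℝ)
    (hmeas_h : Measurable h) (hmeas_x : Measurable x)
    (hw_pos : ∀ i, 0 < w i) (hw_sum : ∑ i, w i = 1)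
    (hprob : ∀ i, P (h ⁻¹' {i}) = ENNReal.ofReal (w i))
    -- common spherical covariance `σ² I`
    (hcond : ∀ i, (ProbabilityTheory.cond P (h ⁻¹' {i})).map x
        = Measure.pi fun j => ProbabilityTheory.gaussianReal (μ i j) σ2)
    (hrank : (Matrix.of fun (r : Fin d) (c : Fin k) => μ c r).rank = k)
    -- population quantities
    (μbar : Fin d → ℝ) (hμbar : ∀ i, μbar i = ∫ ω, x ω i ∂P)
    (S2 : Matrix (Fin d) (Fin d) ℝ)
    (hS2 : S2 = Matrix.of fun i j => ∫ ω, x ω i * x ω j ∂P)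
    (M2 : Matrix (Fin d) (Fin d) ℝ) (hM2 : M2 = ∑ i, w i • Matrix.vecMulVec (μ i) (μ i))
    -- plug-in quantities
    (μhat : Fin d → ℝ) (S2hat : Matrix (Fin d) (Fin d) ℝ)
    (hcovsym : (S2hat - Matrix.vecMulVec μhat μhat).IsHermitian)
    (σ2hat : ℝ) (hσ2hat : σ2hat = kthLargest hcovsym.eigenvalues k)
    (M2hat : Matrix (Fin d) (Fin d) ℝ)
    (hM2hat_rank : M2hat.rank ≤ k)
    -- `M̂₂` is a best rank-`k` approximation to `Σ̂₂ − σ̂² I` in spectral norm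
    (hM2hat_best : ∀ X : Matrix (Fin d) (Fin d) ℝ, X.rank ≤ k →
        spec (S2hat - σ2hat • (1 : Matrix (Fin d) (Fin d) ℝ) - M2hat) ≤
        spec (S2hat - σ2hat • (1 : Matrix (Fin d) (Fin d) ℝ) - X)) :
    |σ2hat - (σ2 : ℝ)| ≤
        spec (S2hat - S2) + 2 * l2norm μbar * l2norm (μhat - μbar)
          + l2norm (μhat - μbar) ^ 2 ∧
    spec (M2hat - M2) ≤
        4 * spec (S2hat - S2) + 4 * l2norm μbar * l2norm (μhat - μbar)
          + 2 * l2norm (μhat - μbar) ^ 2 := by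
  have hmean : ∀ j, μbar j = ∑ i, w i * μ i j := by
    intro j
    rw [hμbar, mix_integral P w _ h x hmeas_h hmeas_x hw_pos hprob hcond (fun y => y j)
      (by fun_prop) (fun i => (pi_memLp (μ i) σ2 j).integrable one_le_two)]
    simp only [pi_mean]
  have hS : S2 = M2 + (σ2 : ℝ) • (1 : Matrix (Fin d) (Fin d) ℝ) := by
    ext r s
    rw [hS2, hM2, Matrix.of_apply,
      mix_integral P w _ h x hmeas_h hmeas_x hw_pos hprob hcond (fun y => y r * y s)
      (by fun_prop) (fun i => (pi_memLp (μ i) σ2 r).integrable_mul (pi_memLp (μ i) σ2 s))]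
    simp only [pi_second, mul_add, Finset.sum_add_distrib, ← Finset.sum_mul, hw_sum]
    simp [Matrix.sum_apply, Matrix.vecMulVec_apply, Matrix.one_apply]
  have hdot : ∀ v, μbar ⬝ᵥ v = ∑ i, w i * (μ i ⬝ᵥ v) := by
    intro v
    have : μbar = ∑ i, w i • μ i := by
      ext j; simp [hmean]
    rw [this, sum_dotProduct]
    simp
  have hquad : ∀ v, v ⬝ᵥ S2 *ᵥ v = (∑ i, w i * (μ i ⬝ᵥ v) ^ 2) + σ2 * (v ⬝ᵥ v) := by
    intro v
    rw [hS, hM2, Matrix.add_mulVec, dotProduct_add, Matrix.sum_mulVec, dotProduct_sum]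
    simp only [Matrix.smul_mulVec, dotProduct_smul, vecMulVec_quad, smul_eq_mul,
      Matrix.one_mulVec]
  have hvar : ∀ v, (∑ i, w i * (μ i ⬝ᵥ v) ^ 2) - (μbar ⬝ᵥ v) ^ 2
      = ∑ i, w i * ((μ i - μbar) ⬝ᵥ v) ^ 2 := by
    intro v
    have : ∀ i, w i * ((μ i - μbar) ⬝ᵥ v) ^ 2 = w i * (μ i ⬝ᵥ v) ^ 2
        - 2 * (μbar ⬝ᵥ v) * (w i * (μ i ⬝ᵥ v)) + w i * (μbar ⬝ᵥ v) ^ 2 := by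
      intro i; rw [sub_dotProduct]; ring
    simp only [this, Finset.sum_add_distrib, Finset.sum_sub_distrib, ← Finset.mul_sum,
      ← Finset.sum_mul, hw_sum, ← hdot]
    ring
  set ε := spec (S2hat - S2) + 2 * l2norm μbar * l2norm (μhat - μbar)
          + l2norm (μhat - μbar) ^ 2 with hε
  have hdiff : ∀ v, |v ⬝ᵥ (S2hat - Matrix.vecMulVec μhat μhat) *ᵥ v
      - ((∑ i, w i * ((μ i - μbar) ⬝ᵥ v) ^ 2) + σ2 * (v ⬝ᵥ v))| ≤ ε * (v ⬝ᵥ v) := by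
    intro v
    have e : v ⬝ᵥ (S2hat - Matrix.vecMulVec μhat μhat) *ᵥ v
      - ((∑ i, w i * ((μ i - μbar) ⬝ᵥ v) ^ 2) + σ2 * (v ⬝ᵥ v))
      = v ⬝ᵥ (S2hat - S2) *ᵥ v - ((μhat - μbar) ⬝ᵥ v) * (2 * (μbar ⬝ᵥ v) + (μhat - μbar) ⬝ᵥ v) := by
      rw [← hvar, Matrix.sub_mulVec, Matrix.sub_mulVec, dotProduct_sub, dotProduct_sub,
        vecMulVec_quad, hquad, sub_dotProduct]
      ring
    rw [e]
    have h1 := quad_le (S2hat - S2) v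
    have h2 := abs_dot_le (μhat - μbar) v
    have h3 := abs_dot_le μbar v
    have h4 : |2 * (μbar ⬝ᵥ v) + (μhat - μbar) ⬝ᵥ v|
        ≤ 2 * (l2norm μbar * l2norm v) + l2norm (μhat - μbar) * l2norm v := by
      refine (abs_add_le _ _).trans ?_
      rw [abs_mul, abs_two]
      linarith
    have h5 := mul_le_mul h2 h4 (abs_nonneg _) ((abs_nonneg _).trans h2)
    rw [← abs_mul] at h5
    refine (abs_sub _ _).trans ?_
    refine (add_le_add h1 h5).trans (le_of_eq ?_)
    rw [← l2norm_sq v, hε]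
    ring
  have part1 : |σ2hat - (σ2 : ℝ)| ≤ ε := by
    rw [abs_le]
    constructor
    · have := kth_lower hk hdk hcovsym (σ2 - ε) (by
        intro v
        have h1 := (abs_le.1 (hdiff v)).1
        have h2 : 0 ≤ ∑ i, w i * ((μ i - μbar) ⬝ᵥ v) ^ 2 :=
          Finset.sum_nonneg fun i _ => mul_nonneg (hw_pos i).le (sq_nonneg _)
        linarith)
      linarith
    · have := kth_upper hk hdk hcovsym (σ2 + ε) w (fun i => μ i - μbar) hw_pos (by
        ext j
        simp [mul_sub, Finset.sum_sub_distrib, ← Finset.sum_mul, hw_sum, ← hmean]) (by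
        intro v hv
        have h1 := (abs_le.1 (hdiff v)).2
        simp only [hv] at h1
        simp at h1
        linarith)
      linarith
  refine ⟨part1, ?_⟩
  have hb := hM2hat_best M2 (by rw [hM2]; exact rank_M2 w μ)
  have e1 : M2hat - M2 = -(S2hat - σ2hat • (1 : Matrix (Fin d) (Fin d) ℝ) - M2hat)
      + (S2hat - σ2hat • (1 : Matrix (Fin d) (Fin d) ℝ) - M2) := by abel
  have e2 : S2hat - σ2hat • (1 : Matrix (Fin d) (Fin d) ℝ) - M2
      = (S2hat - S2) + (-(σ2hat - (σ2 : ℝ))) • (1 : Matrix (Fin d) (Fin d) ℝ) := by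
    rw [hS]; module
  have h1 : spec (M2hat - M2) ≤ _ := e1 ▸ spec_add_le _ _
  rw [spec_neg] at h1
  have h2 : spec (S2hat - σ2hat • (1 : Matrix (Fin d) (Fin d) ℝ) - M2)
      ≤ spec (S2hat - S2) + |σ2hat - (σ2 : ℝ)| := by
    rw [e2]
    refine (spec_add_le _ _).trans ?_
    have := spec_smul_one_le (m := d) (-(σ2hat - (σ2 : ℝ)))
    rw [abs_neg] at this
    linarith
  linarith
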